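/- arXiv:1311.0713 — 3 statements merged into one kernel-verified Lean document; each statement's English description precedes it below -/
import Mathlib

section
/- Let G=(V,E) be a finite simple graph and let k ≤ |V|. If Z ⊆ V is a set of k vertices minimizing deg(Z) among all k-element subsets of V (e.g., the k lowest-degree vertices), then for every U ⊆ V with |U| = k one has t(Z) ≤ 2·t(U). In particular, the set of k lowest-degree vertices is a 2-approximate solution to the unweighted Fixed cost minimum edge cover problem. -/
open Finset

/-- The set of edges of `G` touching `U`, i.e. with at least one endpoint in `U`. -/
def touchingEdges {V : Type*} [Fintype V] [DecidableEq V] (G : SimpleGraph V)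
    [DecidableRel G.Adj] (U : Finset V) : Finset (Sym2 V) :=
  G.edgeFinset.filter (fun e => ∃ v ∈ U, v ∈ e)

/-- The number of edges touching `U` is at most the degree sum of `U`. -/
theorem card_touchingEdges_le_sum_degree {V : Type*} [Fintype V] [DecidableEq V]
    (G : SimpleGraph V) [DecidableRel G.Adj] (U : Finset V) :
    (touchingEdges G U).card ≤ ∑ v ∈ U, G.degree v := by
  have h : touchingEdges G U ⊆ U.biUnion fun v => G.incidenceFinset v := by
    intro e he
    obtain ⟨he, v, hv, hve⟩ := Finset.mem_filter.1 he
    exact Finset.mem_biUnion.2 ⟨v, hv, (G.mem_incidenceFinset v e).2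
      ⟨SimpleGraph.mem_edgeFinset.1 he, hve⟩⟩
  calc (touchingEdges G U).card ≤ (U.biUnion fun v => G.incidenceFinset v).card :=
        Finset.card_le_card h
    _ ≤ ∑ v ∈ U, (G.incidenceFinset v).card := Finset.card_biUnion_le
    _ = ∑ v ∈ U, G.degree v := by simp only [G.card_incidenceFinset_eq_degree]

/-- The degree sum of `U` is at most twice the number of edges touching `U`. -/
theorem sum_degree_le_two_mul_card_touchingEdges {V : Type*} [Fintype V] [DecidableEq V]
    (G : SimpleGraph V) [DecidableRel G.Adj] (U : Finset V) :
    ∑ v ∈ U, G.degree v ≤ 2 * (touchingEdges G U).card := by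
  have h : ∀ v ∈ U, G.degree v =
      ((touchingEdges G U).bipartiteAbove (fun (v : V) (e : Sym2 V) => v ∈ e) v).card := by
    intro v hv
    rw [← G.card_incidenceFinset_eq_degree]
    congr 1
    ext e
    rw [G.mem_incidenceFinset, Finset.mem_bipartiteAbove, touchingEdges, Finset.mem_filter,
      SimpleGraph.mem_edgeFinset]
    exact ⟨fun he => ⟨⟨he.1, v, hv, he.2⟩, he.2⟩, fun he => ⟨he.1.1, he.2⟩⟩
  rw [Finset.sum_congr rfl h, Finset.sum_card_bipartiteAbove_eq_sum_card_bipartiteBelow,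
    mul_comm, ← smul_eq_mul]
  refine Finset.sum_le_card_nsmul _ _ _ fun e _ => ?_
  calc (U.bipartiteBelow (fun (v : V) (e : Sym2 V) => v ∈ e) e).card ≤ e.toFinset.card :=
        Finset.card_le_card fun v hv =>
          Sym2.mem_toFinset.2 ((Finset.mem_bipartiteBelow _).1 hv).2
    _ ≤ 2 := by rw [Sym2.card_toFinset]; split_ifs <;> norm_num

/-- If `Z` is a set of `k` vertices minimizing the degree sum among all `k`-element
subsets (e.g. the `k` lowest-degree vertices), then `t(Z) ≤ 2·t(U)` for every
`k`-element subset `U`; i.e. `Z` is a 2-approximate solution to unweighted FCEC. -/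
theorem klowest_two_approx
    {V : Type*} [Fintype V] [DecidableEq V] (G : SimpleGraph V) [DecidableRel G.Adj]
    (k : ℕ) (hk : k ≤ Fintype.card V)
    (Z : Finset V) (hZcard : Z.card = k)
    (hZmin : ∀ U : Finset V, U.card = k → (∑ v ∈ Z, G.degree v) ≤ ∑ v ∈ U, G.degree v) :
    ∀ U : Finset V, U.card = k → (touchingEdges G Z).card ≤ 2 * (touchingEdges G U).card := by
  intro U hU
  exact (card_touchingEdges_le_sum_degree G Z).trans
    ((hZmin U hU).trans (sum_degree_le_two_mul_card_touchingEdges G U))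
end

section
/- Let Q* be a finite set, let w: Q* → ℝ≥0 and d: Q* → ℝ≥0 be functions, and let W_H ≥ 0 satisfy w(v) ≤ W_H for every v ∈ Q*. Then there exists a subset Q ⊆ Q* such that ∑_{v∈Q} d(v) ≤ (∑_{v∈Q*} d(v))/2 and W_H + ∑_{v∈Q*} w(v) ≤ 2·(W_H + ∑_{v∈Q} w(v)). -/
open Finset

/-- A finite set with weights bounded by `C` in absolute value can be split into two parts whose
weights differ by at most `C`. -/
theorem exists_subset_abs_sum_sub_two_mul_sum_le {α : Type*} [DecidableEq α]
    (s : Finset α) (w : α → ℝ) {C : ℝ} (hC : 0 ≤ C) (hw : ∀ v ∈ s, |w v| ≤ C) :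
    ∃ t ⊆ s, |∑ v ∈ s, w v - 2 * ∑ v ∈ t, w v| ≤ C := by
  induction s using Finset.induction_on with
  | empty => exact ⟨∅, Subset.rfl, by simpa using hC⟩
  | insert a s ha ih =>
    obtain ⟨t, hts, ht⟩ := ih fun v hv => hw v (mem_insert_of_mem hv)
    have hwa := abs_le.mp (hw a (mem_insert_self a s))
    rw [abs_le] at ht
    by_cases h : |w a + (∑ v ∈ s, w v - 2 * ∑ v ∈ t, w v)| ≤ C
    · refine ⟨t, hts.trans (subset_insert a s), ?_⟩
      rwa [sum_insert ha, add_sub_assoc]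
    · refine ⟨insert a t, insert_subset_insert a hts, ?_⟩
      rw [sum_insert ha, sum_insert fun hat => ha (hts hat), abs_le]
      rcases lt_abs.mp (not_le.mp h) with h | h <;> constructor <;> linarith

/-- Combinatorial core of the 2-approximation for Maximum weight `m'`-edge cover:
given nonnegative weights `w` bounded by `WH` and nonnegative degrees `d` on a finite
set `Qstar`, there is a subset `Q` whose degree sum is at most half the total degree
sum, while `WH + w(Qstar) ≤ 2·(WH + w(Q))`. -/
theorem exists_half_degree_heavy_subset {α : Type*} [DecidableEq α]
    (Qstar : Finset α) (w d : α → ℝ) (WH : ℝ) (hWH : 0 ≤ WH)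
    (hw : ∀ v ∈ Qstar, 0 ≤ w v) (hd : ∀ v ∈ Qstar, 0 ≤ d v)
    (hub : ∀ v ∈ Qstar, w v ≤ WH) :
    ∃ Q ⊆ Qstar,
      (∑ v ∈ Q, d v) ≤ (∑ v ∈ Qstar, d v) / 2 ∧
      WH + ∑ v ∈ Qstar, w v ≤ 2 * (WH + ∑ v ∈ Q, w v) := by
  obtain ⟨t, hts, ht⟩ := exists_subset_abs_sum_sub_two_mul_sum_le Qstar w hWH fun v hv =>
    (abs_of_nonneg (hw v hv)).trans_le (hub v hv)
  rw [abs_le] at ht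
  have hw_split := sum_sdiff (f := w) hts
  have hd_split := sum_sdiff (f := d) hts
  rcases le_total (∑ v ∈ t, d v) (∑ v ∈ Qstar \ t, d v) with h | h
  · exact ⟨t, hts, by linarith, by linarith⟩
  · exact ⟨Qstar \ t, sdiff_subset, by linarith, by linarith⟩
end

section
/- Let V be a finite set with |V| = n ≥ 1, let w: V → ℝ>0, and let w_p > 0 satisfy w(v) ≥ w_p for every v ∈ V. Define scaled integral weights w'(v) = ⌊(w(v)/w_p)·n²⌋. Then for any S, S* ⊆ V, if w'(S) ≥ w'(S*) then w(S) ≥ (1 − 1/n²)·w(S*); that is, a set that is optimal under the scaled weights w' loses at most a factor (1 − 1/n²) of the optimum under the original weights w. -/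
open Finset

/-- Weight-scaling step: with positive weights `w ≥ w_p` and scaled integral weights
`w'(v) = ⌊(w(v)/w_p)·n²⌋`, any set `S` that is at least as good as `S*` under `w'`
has `w(S) ≥ (1 − 1/n²)·w(S*)`. -/
theorem scaled_weights_approx
    {V : Type*} [Fintype V] [DecidableEq V] (n : ℕ) (hn : Fintype.card V = n)
    (hn1 : 1 ≤ n) (w : V → ℝ) (wp : ℝ) (hwp : 0 < wp) (hw : ∀ v, wp ≤ w v)
    (w' : V → ℤ) (hw' : ∀ v, w' v = ⌊w v / wp * (n : ℝ) ^ 2⌋)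
    (S Sstar : Finset V) (h : ∑ v ∈ Sstar, w' v ≤ ∑ v ∈ S, w' v) :
    (1 - 1 / (n : ℝ) ^ 2) * (∑ v ∈ Sstar, w v) ≤ ∑ v ∈ S, w v := by
  have hn2 : (0 : ℝ) < (n : ℝ) ^ 2 := by positivity
  have lower (v : V) : (1 - 1 / (n : ℝ) ^ 2) * w v ≤ wp / (n : ℝ) ^ 2 * w' v := by
    have hfloor := (Int.sub_one_lt_floor (w v / wp * (n : ℝ) ^ 2)).le
    rw [← hw' v] at hfloor
    calc (1 - 1 / (n : ℝ) ^ 2) * w v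
        ≤ w v - wp / (n : ℝ) ^ 2 := by
          have := div_le_div_of_nonneg_right (hw v) hn2.le
          linarith [show (1 - 1 / (n : ℝ) ^ 2) * w v = w v - w v / (n : ℝ) ^ 2 by ring]
      _ = wp / (n : ℝ) ^ 2 * (w v / wp * (n : ℝ) ^ 2 - 1) := by field_simp
      _ ≤ wp / (n : ℝ) ^ 2 * w' v := by gcongr
  have upper (v : V) : wp / (n : ℝ) ^ 2 * w' v ≤ w v := by
    have hfloor := Int.floor_le (w v / wp * (n : ℝ) ^ 2)
    rw [← hw' v] at hfloor
    calc wp / (n : ℝ) ^ 2 * w' v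
        ≤ wp / (n : ℝ) ^ 2 * (w v / wp * (n : ℝ) ^ 2) := by gcongr
      _ = w v := by field_simp
  have h_cast : ∑ v ∈ Sstar, (w' v : ℝ) ≤ ∑ v ∈ S, (w' v : ℝ) := by exact_mod_cast h
  calc (1 - 1 / (n : ℝ) ^ 2) * ∑ v ∈ Sstar, w v
      = ∑ v ∈ Sstar, (1 - 1 / (n : ℝ) ^ 2) * w v := Finset.mul_sum ..
    _ ≤ ∑ v ∈ Sstar, wp / (n : ℝ) ^ 2 * w' v := Finset.sum_le_sum fun v _ => lower v
    _ = wp / (n : ℝ) ^ 2 * ∑ v ∈ Sstar, (w' v : ℝ) := (Finset.mul_sum ..).symm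
    _ ≤ wp / (n : ℝ) ^ 2 * ∑ v ∈ S, (w' v : ℝ) := by gcongr
    _ = ∑ v ∈ S, wp / (n : ℝ) ^ 2 * w' v := Finset.mul_sum ..
    _ ≤ ∑ v ∈ S, w v := Finset.sum_le_sum fun v _ => upper v
end
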